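/- arXiv:2302.05500 — 2 statements merged into one kernel-verified Lean document; each statement's English description precedes it below -/
import Mathlib

section
/- For every bounded continuous φ: [0,∞) → ℝ, all t₁, t₂ > 0, and all x₁, x₂ ≥ 0, writing m = min{t₁, t₂}, one has |(S(t₁)φ)(x₁) − (S(t₂)φ)(x₂)| ≤ ((1 + μm)·e^{−μm}·‖φ‖ / m)·|t₂ − t₁| + (e^{−μm}·‖φ‖ / √(πm))·|x₂ − x₁|. -/
open Set Real MeasureTheory

/-- The Dirichlet heat kernel on the half-line:
`G(t,x,y) = (4πt)^{-1/2} (exp(-(x-y)²/(4t)) - exp(-(x+y)²/(4t)))`. -/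
noncomputable def heatG (t x y : ℝ) : ℝ :=
  (1 / Real.sqrt (4 * Real.pi * t)) *
    (Real.exp (-(x - y) ^ 2 / (4 * t)) - Real.exp (-(x + y) ^ 2 / (4 * t)))

/-- The semigroup `(S(t)φ)(x) = e^{-μt} ∫₀^∞ G(t,x,y) φ(y) dy`, with `S(0)φ = φ`. -/
noncomputable def heatS (μ t : ℝ) (φ : ℝ → ℝ) (x : ℝ) : ℝ :=
  if t = 0 then φ x
  else Real.exp (-μ * t) * ∫ y in Set.Ioi (0:ℝ), heatG t x y * φ y

/-- The supremum norm `‖φ‖ = sup_{x ≥ 0} |φ x|`. -/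
noncomputable def supnorm (φ : ℝ → ℝ) : ℝ := ⨆ x : Set.Ici (0:ℝ), |φ (x : ℝ)|

lemma shift_Ioi (f : ℝ → ℝ) (d : ℝ) : ∫ y in Ioi (0:ℝ), f (y + d) = ∫ y in Ioi d, f y := by
  rw [← (measurePreserving_add_right volume d).setIntegral_preimage_emb
    (measurableEmbedding_addRight d) f (Ioi d)]
  simp

noncomputable def hK (t z : ℝ) : ℝ := (1 / Real.sqrt (4 * Real.pi * t)) * Real.exp (-z ^ 2 / (4 * t))

lemma hK_nonneg (t z : ℝ) : 0 ≤ hK t z := by unfold hK; positivity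

lemma hK_eq (t : ℝ) : hK t = fun z => (1 / Real.sqrt (4 * Real.pi * t)) * Real.exp (-(1 / (4 * t)) * z ^ 2) := by
  funext z
  unfold hK
  congr 2
  ring

lemma hK_int {t : ℝ} (ht : 0 < t) : Integrable (hK t) := by
  rw [hK_eq]
  exact (integrable_exp_neg_mul_sq (by positivity)).const_mul _

lemma hK_integral {t : ℝ} (ht : 0 < t) : ∫ z, hK t z = 1 := by
  rw [hK_eq, integral_const_mul, integral_gaussian]
  have : Real.pi / (1 / (4 * t)) = 4 * Real.pi * t := by field_simp
  rw [this]
  have : 0 < Real.sqrt (4 * Real.pi * t) := by positivity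
  field_simp

lemma hK_integral_Ioi {t : ℝ} (ht : 0 < t) : ∫ z in Ioi (0:ℝ), hK t z = 1 / 2 := by
  rw [hK_eq, integral_const_mul, integral_gaussian_Ioi]
  have : Real.pi / (1 / (4 * t)) = 4 * Real.pi * t := by field_simp
  rw [this]
  have : 0 < Real.sqrt (4 * Real.pi * t) := by positivity
  field_simp

lemma hK_neg (t z : ℝ) : hK t (-z) = hK t z := by simp [hK]

lemma hK_anti {t : ℝ} (ht : 0 < t) {a b : ℝ} (h : |a| ≤ |b|) : hK t b ≤ hK t a := by
  unfold hK
  have := sq_le_sq.2 h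
  gcongr

lemma fold_int {D : ℝ → ℝ} (hD : Integrable D) :
    ∫ y in Ioi (0:ℝ), (D y + D (-y)) = ∫ y, D y := by
  rw [integral_add hD.integrableOn hD.comp_neg.integrableOn, integral_comp_neg_Ioi, neg_zero, add_comm]
  exact intervalIntegral.integral_Iic_add_Ioi hD.integrableOn hD.integrableOn

lemma gen {φ A B D : ℝ → ℝ} {N : ℝ} (hcont : ContinuousOn φ (Set.Ici 0))
    (hN : ∀ y ≥ (0:ℝ), |φ y| ≤ N) (hA : IntegrableOn A (Ioi 0)) (hB : IntegrableOn B (Ioi 0))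
    (hD : Integrable D) (h : ∀ y > 0, |A y - B y| ≤ D y + D (-y)) :
    |(∫ y in Ioi (0:ℝ), A y * φ y) - ∫ y in Ioi (0:ℝ), B y * φ y| ≤ N * ∫ y, D y := by
  have hN0 : 0 ≤ N := (abs_nonneg _).trans (hN 0 le_rfl)
  have hm : AEStronglyMeasurable φ (volume.restrict (Ioi 0)) :=
    (hcont.mono Ioi_subset_Ici_self).aestronglyMeasurable measurableSet_Ioi
  have hb : ∀ᵐ y ∂(volume.restrict (Ioi (0:ℝ))), ‖φ y‖ ≤ N := by
    filter_upwards [ae_restrict_mem measurableSet_Ioi] with y hy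
    exact hN y (le_of_lt hy)
  have hAi : IntegrableOn (fun y => A y * φ y) (Ioi 0) := Integrable.mul_bdd hA hm hb
  have hBi : IntegrableOn (fun y => B y * φ y) (Ioi 0) := Integrable.mul_bdd hB hm hb
  rw [← integral_sub hAi hBi, ← fold_int hD, ← integral_const_mul, ← Real.norm_eq_abs]
  refine norm_integral_le_of_norm_le ((hD.integrableOn.add hD.comp_neg.integrableOn).const_mul N) ?_
  filter_upwards [ae_restrict_mem measurableSet_Ioi] with y hy
  rw [← sub_mul, norm_mul, mul_comm]
  exact mul_le_mul (hN y (le_of_lt hy)) (h y hy) (norm_nonneg _) hN0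

lemma heatG_eq (t x y : ℝ) : heatG t x y = hK t (x + -y) - hK t (x + y) := by
  unfold heatG hK; ring_nf

lemma heatG_int {t : ℝ} (ht : 0 < t) (x : ℝ) : IntegrableOn (heatG t x) (Ioi 0) := by
  have : heatG t x = fun y => hK t (x + -y) - hK t (x + y) := funext (heatG_eq t x)
  rw [this]
  have h := (hK_int ht).comp_add_left x
  exact (h.comp_neg.sub h).integrableOn

lemma bound0 {φ : ℝ → ℝ} {N t : ℝ} (hcont : ContinuousOn φ (Set.Ici 0))
    (hN : ∀ y ≥ (0:ℝ), |φ y| ≤ N) (ht : 0 < t) (x : ℝ) :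
    |∫ y in Ioi (0:ℝ), heatG t x y * φ y| ≤ N := by
  have := gen (B := fun _ => 0) (D := fun y => hK t (x + y)) hcont hN (heatG_int ht x)
    integrableOn_zero ((hK_int ht).comp_add_left x) (fun y _ => by
      rw [sub_zero, heatG_eq, abs_le]
      have h1 := hK_nonneg t (x + y)
      have h2 := hK_nonneg t (x + -y)
      constructor <;> linarith)
  rw [integral_add_left_eq_self (hK t) x, hK_integral ht] at this
  simpa using this

lemma boundD {φ : ℝ → ℝ} {N s t : ℝ} (hcont : ContinuousOn φ (Set.Ici 0))
    (hN : ∀ y ≥ (0:ℝ), |φ y| ≤ N) (hs : 0 < s) (ht : 0 < t) (x x' : ℝ) :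
    |(∫ y in Ioi (0:ℝ), heatG s x y * φ y) - ∫ y in Ioi (0:ℝ), heatG t x' y * φ y|
      ≤ N * ∫ y, |hK s (x + y) - hK t (x' + y)| := by
  refine gen hcont hN (heatG_int hs x) (heatG_int ht x')
    (((hK_int hs).comp_add_left x).sub ((hK_int ht).comp_add_left x')).abs (fun y _ => ?_)
  rw [heatG_eq, heatG_eq]
  have := abs_sub (hK s (x + -y) - hK t (x' + -y)) (hK s (x + y) - hK t (x' + y))
  refine le_trans (le_of_eq ?_) (this.trans (le_of_eq ?_))
  · congr 1; ring
  · ring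

lemma time_est {s t : ℝ} (hs : 0 < s) (hst : s ≤ t) (x : ℝ) :
    ∫ y, |hK s (x + y) - hK t (x + y)| ≤ (t - s) / s := by
  have ht := hs.trans_le hst
  rw [integral_add_left_eq_self (fun y => |hK s y - hK t y|) x]
  set a := Real.sqrt s with ha
  set b := Real.sqrt t with hb
  have ha0 : 0 < a := Real.sqrt_pos.2 hs
  have hab : a ≤ b := Real.sqrt_le_sqrt hst
  have hb0 : 0 < b := ha0.trans_le hab
  have hsa : s = a ^ 2 := (Real.sq_sqrt hs.le).symm
  have htb : t = b ^ 2 := (Real.sq_sqrt ht.le).symm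
  have hq : a / b ≤ 1 := (div_le_one hb0).2 hab
  have key : ∀ y, (a / b) * hK s y ≤ hK t y := by
    intro y
    unfold hK
    rw [Real.sqrt_mul (by positivity) s, Real.sqrt_mul (by positivity) t, ← ha, ← hb]
    have h1 : a / b * (1 / (√(4 * π) * a) * rexp (-y ^ 2 / (4 * s))) = 1 / (√(4 * π) * b) * rexp (-y ^ 2 / (4 * s)) := by
      have : 0 < √(4 * π) := by positivity
      field_simp
    rw [h1]
    refine mul_le_mul_of_nonneg_left (Real.exp_le_exp.2 ?_) (by positivity)
    rw [neg_div, neg_div]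
    apply neg_le_neg
    gcongr
  calc ∫ y, |hK s y - hK t y| ≤ ∫ y, ((1 - 2 * (a / b)) * hK s y + hK t y) := by
        refine integral_mono ((hK_int hs).sub (hK_int ht)).abs
          (((hK_int hs).const_mul _).add (hK_int ht)) (fun y => ?_)
        have h1 := key y
        have h2 := mul_le_mul_of_nonneg_right hq (hK_nonneg s y)
        show |hK s y - hK t y| ≤ (1 - 2 * (a / b)) * hK s y + hK t y
        rw [abs_le]
        constructor <;> linarith
    _ = 2 * (1 - a / b) := by
        rw [integral_add ((hK_int hs).const_mul _) (hK_int ht), integral_const_mul, hK_integral hs, hK_integral ht]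
        ring
    _ ≤ (t - s) / s := by
        rw [hsa, htb, le_div_iff₀ (by positivity)]
        have : 2 * (1 - a / b) * a ^ 2 = 2 * (b - a) * a ^ 2 / b := by field_simp
        rw [this, div_le_iff₀ hb0]
        have : 0 ≤ (b - a) * (b * (b + a) - 2 * a ^ 2) := by
          apply mul_nonneg <;> nlinarith
        nlinarith

lemma space_est' {t : ℝ} (ht : 0 < t) {x x' : ℝ} (h : x ≤ x') :
    ∫ y, |hK t (x + y) - hK t (x' + y)| ≤ (x' - x) / Real.sqrt (Real.pi * t) := by
  set d := (x' - x) / 2 with hd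
  have hd0 : 0 ≤ d := by rw [hd]; linarith
  set c := (x + x') / 2 with hc
  have e1 : x = c - d := by rw [hc, hd]; ring
  have e2 : x' = c + d := by rw [hc, hd]; ring
  have hi1 : Integrable (fun y => hK t (y - d)) := (hK_int ht).comp_sub_right d
  have hi2 : Integrable (fun y => hK t (y + d)) := (hK_int ht).comp_add_right d
  have s1 : ∫ y, |hK t (x + y) - hK t (x' + y)| = ∫ y, |hK t (y - d) - hK t (y + d)| := by
    rw [← integral_add_left_eq_self (fun y => |hK t (y - d) - hK t (y + d)|) c]
    congr 1; funext y; rw [e1, e2]; ring_nf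
  have hi : Integrable (fun y => |hK t (y - d) - hK t (y + d)|) := (hi1.sub hi2).abs
  have s2 : ∫ y in Ioi (0:ℝ), |hK t (y - d) - hK t (y + d)| =
      (∫ y in Ioi (0:ℝ), hK t (y - d)) - ∫ y in Ioi (0:ℝ), hK t (y + d) := by
    rw [← integral_sub hi1.integrableOn hi2.integrableOn]
    refine setIntegral_congr_fun measurableSet_Ioi (fun y hy => ?_)
    have hy : 0 < y := hy
    refine abs_of_nonneg (sub_nonneg.2 (hK_anti ht ?_))
    rw [abs_of_nonneg (by linarith : 0 ≤ y + d), abs_le]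
    constructor <;> linarith
  have s3 : ∫ y, |hK t (y - d) - hK t (y + d)| = 2 * ∫ y in Ioi (0:ℝ), |hK t (y - d) - hK t (y + d)| := by
    rw [← fold_int hi, ← integral_const_mul]
    refine integral_congr_ae (Filter.Eventually.of_forall fun y => ?_)
    show |hK t (y - d) - hK t (y + d)| + |hK t (-y - d) - hK t (-y + d)| = 2 * |hK t (y - d) - hK t (y + d)|
    rw [← hK_neg t (-y - d), ← hK_neg t (-y + d), abs_sub_comm (hK t (-(-y - d)))]
    rw [show -(-y + d) = y - d by ring, show -(-y - d) = y + d by ring]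
    ring
  have s4 : ∫ y in Ioi (0:ℝ), hK t (y - d) = ∫ y in Ioi (-d), hK t y := by
    have := shift_Ioi (hK t) (-d)
    simpa [sub_eq_add_neg] using this
  have s5 : ∫ y in Ioi (0:ℝ), hK t (y + d) = ∫ y in Ioi d, hK t y := by
    have := shift_Ioi (hK t) d
    simpa using this
  have s6 : (∫ y in Ioi (-d), hK t y) - ∫ y in Ioi d, hK t y = ∫ y in (-d)..d, hK t y :=
    intervalIntegral.integral_Ioi_sub_Ioi (hK_int ht).integrableOn (by linarith)
  have s7 : ∫ y in (-d)..d, hK t y ≤ ∫ y in (-d)..d, hK t 0 := by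
    refine intervalIntegral.integral_mono_on (by linarith) (hK_int ht).intervalIntegrable
      intervalIntegrable_const (fun y _ => hK_anti ht (by simp))
  rw [intervalIntegral.integral_const] at s7
  rw [s1, s3, s2, s4, s5, s6]
  have h0 : hK t 0 = 1 / (2 * √(π * t)) := by
    unfold hK
    rw [show 4 * π * t = 2 ^ 2 * (π * t) by ring, Real.sqrt_mul (by positivity), Real.sqrt_sq (by norm_num)]
    simp
  rw [h0, smul_eq_mul] at s7
  have h1 : 0 < √(π * t) := by positivity
  refine (mul_le_mul_of_nonneg_left s7 (by norm_num)).trans (le_of_eq ?_)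
  rw [hd]; field_simp; ring

lemma space_est {t : ℝ} (ht : 0 < t) (x x' : ℝ) :
    ∫ y, |hK t (x + y) - hK t (x' + y)| ≤ |x' - x| / Real.sqrt (Real.pi * t) := by
  rcases le_total x x' with h | h
  · rw [abs_of_nonneg (by linarith)]; exact space_est' ht h
  · rw [abs_sub_comm x' x, abs_of_nonneg (by linarith : 0 ≤ x - x')]
    simp_rw [abs_sub_comm (hK t (x + _))]
    exact space_est' ht h

lemma main_le {μ : ℝ} (hμ : 0 < μ) {φ : ℝ → ℝ} {N : ℝ}
    (hcont : ContinuousOn φ (Set.Ici 0)) (hN : ∀ y ≥ (0:ℝ), |φ y| ≤ N)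
    {s t : ℝ} (hs : 0 < s) (hst : s ≤ t) (x₁ x₂ : ℝ) :
    |heatS μ s φ x₁ - heatS μ t φ x₂| ≤
      ((1 + μ * s) * Real.exp (-μ * s) * N / s) * |t - s|
        + (Real.exp (-μ * s) * N / Real.sqrt (Real.pi * s)) * |x₂ - x₁| := by
  have ht := hs.trans_le hst
  have hN0 : 0 ≤ N := (abs_nonneg _).trans (hN 0 le_rfl)
  unfold heatS
  rw [if_neg hs.ne', if_neg ht.ne', abs_of_nonneg (sub_nonneg.2 hst)]
  have b0 := bound0 hcont hN hs x₂
  have b1 := (boundD hcont hN hs hs x₁ x₂).trans (mul_le_mul_of_nonneg_left (space_est hs x₁ x₂) hN0)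
  have b2 := (boundD hcont hN hs ht x₂ x₂).trans (mul_le_mul_of_nonneg_left (time_est hs hst x₂) hN0)
  set I1 := ∫ y in Ioi (0:ℝ), heatG s x₁ y * φ y
  set I2 := ∫ y in Ioi (0:ℝ), heatG s x₂ y * φ y
  set I3 := ∫ y in Ioi (0:ℝ), heatG t x₂ y * φ y
  set e1 := rexp (-μ * s) with he1
  set e2 := rexp (-μ * t) with he2
  have p1 : 0 < e1 := Real.exp_pos _
  have p2 : 0 < e2 := Real.exp_pos _
  have h21 : e2 ≤ e1 := Real.exp_le_exp.2 (by nlinarith)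
  have hdiff : e1 - e2 ≤ e1 * (μ * (t - s)) := by
    have : e2 = e1 * rexp (-(μ * (t - s))) := by
      rw [he1, he2, ← Real.exp_add]; congr 1; ring
    rw [this]
    have := Real.add_one_le_exp (-(μ * (t - s)))
    nlinarith
  have split : e1 * I1 - e2 * I3 = e1 * (I1 - I2) + (e1 - e2) * I2 + e2 * (I2 - I3) := by ring
  rw [split]
  refine (abs_add_three _ _ _).trans ?_
  rw [abs_mul, abs_mul, abs_mul, abs_of_pos p1, abs_of_pos p2, abs_of_nonneg (sub_nonneg.2 h21)]
  have c1 := mul_le_mul_of_nonneg_left b1 p1.le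
  have c2 : (e1 - e2) * |I2| ≤ e1 * (μ * (t - s)) * N :=
    mul_le_mul hdiff b0 (abs_nonneg _) ((sub_nonneg.2 h21).trans hdiff)
  have c3 : e2 * |I2 - I3| ≤ e1 * (N * ((t - s) / s)) :=
    mul_le_mul h21 b2 (abs_nonneg _) p1.le
  refine (add_le_add (add_le_add c1 c2) c3).trans (le_of_eq ?_)
  field_simp
  ring

/-- Lemma 3.1 (iv): joint Lipschitz-type estimate. With `m = min{t₁,t₂}`,
`|(S(t₁)φ)(x₁) - (S(t₂)φ)(x₂)| ≤ ((1+μm) e^{-μm} ‖φ‖ / m) |t₂-t₁| + (e^{-μm} ‖φ‖/√(πm)) |x₂-x₁|`. -/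
theorem stmt_8 (μ : ℝ) (hμ : 0 < μ) (φ : ℝ → ℝ)
    (hcont : ContinuousOn φ (Set.Ici 0))
    (hbdd : ∃ M, ∀ x ≥ (0:ℝ), |φ x| ≤ M) :
    ∀ t₁ > (0:ℝ), ∀ t₂ > (0:ℝ), ∀ x₁ ≥ (0:ℝ), ∀ x₂ ≥ (0:ℝ),
      |heatS μ t₁ φ x₁ - heatS μ t₂ φ x₂| ≤
        ((1 + μ * min t₁ t₂) * Real.exp (-μ * min t₁ t₂) * supnorm φ / min t₁ t₂) *
            |t₂ - t₁|
          + (Real.exp (-μ * min t₁ t₂) * supnorm φ / Real.sqrt (Real.pi * min t₁ t₂)) *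
            |x₂ - x₁| := by
  intro t₁ h₁ t₂ h₂ x₁ _ x₂ _
  have hN : ∀ y ≥ (0:ℝ), |φ y| ≤ supnorm φ := by
    obtain ⟨M, hM⟩ := hbdd
    intro y hy
    exact le_ciSup (f := fun x : Set.Ici (0:ℝ) => |φ (x : ℝ)|)
      ⟨M, by rintro _ ⟨z, rfl⟩; exact hM z z.2⟩ ⟨y, hy⟩
  rcases le_total t₁ t₂ with h | h
  · rw [min_eq_left h]
    exact main_le hμ hcont hN h₁ h x₁ x₂
  · rw [min_eq_right h, abs_sub_comm, abs_sub_comm t₂, abs_sub_comm x₂]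
    exact main_le hμ hcont hN h₂ h x₂ x₁
end

section
/- Assume f: ℝ → ℝ is continuously differentiable with f(0) = 0 and |f′(s)| ≤ L_f for all s ∈ ℝ, where L_f > 0. Let T > 0, ψ ∈ C, let ζ: [−τ, T] → X be continuous and bounded and h: [0, T] → X continuous and bounded, and for a continuous function u: [−τ, T] → X with u = ψ on [−τ, 0] define (Λu)(t) = S(t)ψ(0) + ε∫₀ᵗ S(t−r) K[f∘(u(r−τ) + ζ(r−τ))] dr + ∫₀ᵗ S(t−r) h(r) dr for t ∈ (0, T] and (Λu)(t) = ψ(t) for t ∈ [−τ, 0]. Then for any two continuous u¹, u²: [−τ, T] → X that both equal ψ on [−τ, 0], and every t ∈ [0, T], ‖(Λu¹)(t) − (Λu²)(t)‖ ≤ (ε L_f / μ)·(1 − e^{−μt})·sup_{s ∈ [−τ, t]} ‖u¹(s) − u²(s)‖. -/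
open Set Real MeasureTheory intervalIntegral

/-- The nonlocal operator `(Kφ)(x) = ∫₀^∞ Γ(α,x,y) φ(y) dy`. -/
noncomputable def Kop (α : ℝ) (φ : ℝ → ℝ) (x : ℝ) : ℝ :=
  ∫ y in Set.Ioi (0:ℝ), heatG α x y * φ y

/-- The supremum norm `‖φ‖ = sup_{x ≥ 0} |φ x|` of the phase space `X`. -/
noncomputable def Xnorm (φ : ℝ → ℝ) : ℝ := ⨆ x : Set.Ici (0:ℝ), |φ (x : ℝ)|

/-- Membership in the phase space `X`: bounded, uniformly continuous on `[0,∞)`, vanishing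
at `0`. -/
def InX (φ : ℝ → ℝ) : Prop :=
  (∃ M, ∀ x ≥ (0:ℝ), |φ x| ≤ M) ∧ UniformContinuousOn φ (Set.Ici 0) ∧ φ 0 = 0

/-- Continuity of a curve `t ↦ v t` with respect to the supremum norm of `X`, on a set `s`. -/
def XContOn (v : ℝ → ℝ → ℝ) (s : Set ℝ) : Prop :=
  ∀ t ∈ s, ∀ ε > (0:ℝ), ∃ δ > (0:ℝ), ∀ t' ∈ s, |t' - t| < δ →
    Xnorm (fun x => v t' x - v t x) < ε

/-- Boundedness of a curve `t ↦ v t` in the supremum norm of `X`, on a set `s`. -/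
def XBddOn (v : ℝ → ℝ → ℝ) (s : Set ℝ) : Prop :=
  ∃ M, ∀ t ∈ s, Xnorm (v t) ≤ M

/-- A mild solution with delay `τ`, initial datum `ψ`, noise path `ζ` and forcing `h`:
a continuous `X`-valued curve `v` on `[-τ, ∞)` with `v = ψ` on `[-τ, 0]` satisfying
`v(t) = S(t)ψ(0) + ε ∫₀ᵗ S(t-r) K[f ∘ (v(r-τ) + ζ(r-τ))] dr + ∫₀ᵗ S(t-r) h(r) dr`. -/
def IsMildSolution (μ ε α τ : ℝ) (f : ℝ → ℝ) (ψ ζ h v : ℝ → ℝ → ℝ) : Prop :=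
  (∀ t ∈ Set.Ici (-τ), InX (v t)) ∧
  XContOn v (Set.Ici (-τ)) ∧
  (∀ t ∈ Set.Icc (-τ) (0:ℝ), ∀ x, v t x = ψ t x) ∧
  (∀ t ≥ (0:ℝ), ∀ x ≥ (0:ℝ),
    v t x = heatS μ t (ψ 0) x
      + ε * (∫ r in (0:ℝ)..t,
          heatS μ (t - r) (Kop α (fun y => f (v (r - τ) y + ζ (r - τ) y))) x)
      + ∫ r in (0:ℝ)..t, heatS μ (t - r) (h r) x)

/-- The fixed-point operator `Λ`: `(Λu)(t) = ψ(t)` for `t ∈ [-τ, 0]`, and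
`(Λu)(t) = S(t)ψ(0) + ε ∫₀ᵗ S(t-r) K[f ∘ (u(r-τ) + ζ(r-τ))] dr + ∫₀ᵗ S(t-r) h(r) dr`
for `t > 0`. -/
noncomputable def Lam (μ ε α τ : ℝ) (f : ℝ → ℝ) (ζ h ψ u : ℝ → ℝ → ℝ) (t x : ℝ) : ℝ :=
  if t ≤ 0 then ψ t x
  else heatS μ t (ψ 0) x
    + ε * (∫ r in (0:ℝ)..t,
        heatS μ (t - r) (Kop α (fun y => f (u (r - τ) y + ζ (r - τ) y))) x)
    + ∫ r in (0:ℝ)..t, heatS μ (t - r) (h r) x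

lemma aux_le_Xnorm (φ : ℝ → ℝ) (hb : ∃ M, ∀ x ≥ (0:ℝ), |φ x| ≤ M) (x : ℝ) (hx : 0 ≤ x) :
    |φ x| ≤ Xnorm φ := by
  obtain ⟨M, hM⟩ := hb
  have hB : BddAbove (Set.range fun x : Set.Ici (0:ℝ) => |φ (x:ℝ)|) :=
    ⟨M, by rintro _ ⟨y, rfl⟩; exact hM y y.2⟩
  exact le_ciSup hB ⟨x, hx⟩

lemma aux_Xnorm_le (φ : ℝ → ℝ) (M : ℝ) (hM : ∀ x ≥ (0:ℝ), |φ x| ≤ M) : Xnorm φ ≤ M := by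
  have : Nonempty (Set.Ici (0:ℝ)) := ⟨⟨0, by simp⟩⟩
  exact ciSup_le fun x => hM x x.2

lemma aux_bdd_sub {φ χ : ℝ → ℝ} (h1 : ∃ M, ∀ x ≥ (0:ℝ), |φ x| ≤ M)
    (h2 : ∃ M, ∀ x ≥ (0:ℝ), |χ x| ≤ M) : ∃ M, ∀ x ≥ (0:ℝ), |φ x - χ x| ≤ M := by
  obtain ⟨M, hM⟩ := h1
  obtain ⟨N, hN⟩ := h2
  exact ⟨M + N, fun x hx => (abs_sub _ _).trans (add_le_add (hM x hx) (hN x hx))⟩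

lemma aux_unif_bdd (v : ℝ → ℝ → ℝ) (a b : ℝ) (hX : ∀ t ∈ Set.Icc a b, InX (v t))
    (hc : XContOn v (Set.Icc a b)) : ∃ M, ∀ t ∈ Set.Icc a b, ∀ x ≥ (0:ℝ), |v t x| ≤ M := by
  refine (isCompact_Icc (a := a) (b := b)).induction_on
    (p := fun s => ∃ M, ∀ t ∈ s, ∀ x ≥ (0:ℝ), |v t x| ≤ M) ⟨0, by simp⟩ ?_ ?_ ?_
  · rintro s t hst ⟨M, hM⟩
    exact ⟨M, fun r hr => hM r (hst hr)⟩
  · rintro s t ⟨M, hM⟩ ⟨N, hN⟩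
    refine ⟨max M N, ?_⟩
    rintro r (hr | hr) x hx
    · exact (hM r hr x hx).trans (le_max_left _ _)
    · exact (hN r hr x hx).trans (le_max_right _ _)
  · intro t ht
    obtain ⟨δ, hδ, H⟩ := hc t ht 1 one_pos
    obtain ⟨M, hM⟩ := (hX t ht).1
    refine ⟨Set.Icc a b ∩ Metric.ball t δ,
      inter_mem_nhdsWithin _ (Metric.ball_mem_nhds t hδ), M + 1, ?_⟩
    rintro r ⟨hr, hr2⟩ x hx
    have h1 := H r hr (by simpa [Real.dist_eq] using hr2)
    have h2 := aux_le_Xnorm (fun x => v r x - v t x) (aux_bdd_sub (hX r hr).1 (hX t ht).1) x hx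
    have h3 := hM x hx
    have h4 : |v r x| ≤ |v r x - v t x| + |v t x| := by
      simpa using abs_add_le (v r x - v t x) (v t x)
    linarith

lemma aux_contOn (v : ℝ → ℝ → ℝ) (a b : ℝ) (hX : ∀ t ∈ Set.Icc a b, InX (v t))
    (hc : XContOn v (Set.Icc a b)) :
    ContinuousOn (fun p : ℝ × ℝ => v p.1 p.2) (Set.Icc a b ×ˢ Set.Ici 0) := by
  rw [Metric.continuousOn_iff]
  rintro ⟨t, x⟩ ⟨ht, hx⟩ e he
  obtain ⟨δ, hδ, H⟩ := hc t ht (e / 2) (by linarith)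
  have hxc : ContinuousOn (v t) (Set.Ici 0) := (hX t ht).2.1.continuousOn
  obtain ⟨δ', hδ', H'⟩ := Metric.continuousOn_iff.1 hxc x hx (e / 2) (by linarith)
  refine ⟨min δ δ', lt_min hδ hδ', ?_⟩
  rintro ⟨r, y⟩ ⟨hr, hy⟩ hd
  simp only [Prod.dist_eq, max_lt_iff, lt_min_iff] at hd
  simp only at ht hx hr hy
  have h1 := H r hr (by simpa [Real.dist_eq] using hd.1.1)
  have h2 := aux_le_Xnorm (fun x => v r x - v t x) (aux_bdd_sub (hX r hr).1 (hX t ht).1) y hy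
  have h3 := H' y hy hd.2.2
  rw [Real.dist_eq] at h3 ⊢
  have h4 := abs_add_le (v r y - v t y) (v t y - v t x)
  simp only [sub_add_sub_cancel] at h4 h2
  simp only
  linarith

lemma aux_cont (v : ℝ → ℝ → ℝ) (a b : ℝ) (hab : a ≤ b) (hX : ∀ t ∈ Set.Icc a b, InX (v t))
    (hc : XContOn v (Set.Icc a b)) :
    Continuous (fun p : ℝ × ℝ => v (max a (min b p.1)) (max p.2 0)) := by
  have h := (aux_contOn v a b hX hc).comp_continuous
    (f := fun p : ℝ × ℝ => (max a (min b p.1), max p.2 0)) (by fun_prop)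
    (fun p => ⟨⟨le_max_left _ _, max_le hab (min_le_left _ _)⟩, le_max_right p.2 0⟩)
  exact h

lemma aux_G_le (t x y : ℝ) (ht : 0 < t) (hx : 0 ≤ x) (hy : 0 ≤ y) :
    |heatG t x y| ≤ ProbabilityTheory.gaussianPDFReal x (Real.toNNReal (2 * t)) y := by
  have e2 : ((Real.toNNReal (2 * t) : NNReal) : ℝ) = 2 * t := Real.coe_toNNReal _ (by linarith)
  unfold heatG ProbabilityTheory.gaussianPDFReal
  rw [e2, abs_mul, abs_of_nonneg (by positivity : 0 ≤ 1 / √(4 * π * t)), one_div]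
  rw [show 2 * π * (2 * t) = 4 * π * t by ring, show 2 * (2 * t) = 4 * t by ring,
    show (y - x) ^ 2 = (x - y) ^ 2 by ring]
  gcongr
  have h1 : Real.exp (-(x + y) ^ 2 / (4 * t)) ≤ Real.exp (-(x - y) ^ 2 / (4 * t)) := by
    apply Real.exp_le_exp.2
    apply div_le_div_of_nonneg_right _ (by positivity)
    nlinarith [mul_nonneg hx hy]
  have h2 := Real.exp_pos (-(x + y) ^ 2 / (4 * t))
  rw [abs_of_nonneg (by linarith)]
  linarith

lemma aux_G_meas : Measurable (fun p : ℝ × ℝ × ℝ => heatG p.1 p.2.1 p.2.2) := by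
  unfold heatG
  fun_prop

lemma aux_bound (t x M : ℝ) (ht : 0 < t) (hx : 0 ≤ x) (φ : ℝ → ℝ) (hφ : ∀ y ≥ 0, |φ y| ≤ M) :
    |∫ y in Set.Ioi (0:ℝ), heatG t x y * φ y| ≤ M := by
  have hM : 0 ≤ M := (abs_nonneg _).trans (hφ 0 le_rfl)
  have hint := ProbabilityTheory.integrable_gaussianPDFReal x (Real.toNNReal (2 * t))
  have h1 : ‖∫ y in Set.Ioi (0:ℝ), heatG t x y * φ y‖ ≤
      ∫ y in Set.Ioi (0:ℝ), ProbabilityTheory.gaussianPDFReal x (Real.toNNReal (2 * t)) y * M := by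
    refine norm_integral_le_of_norm_le (hint.mul_const M).integrableOn ?_
    refine (ae_restrict_iff' measurableSet_Ioi).2 (Filter.Eventually.of_forall fun y hy => ?_)
    rw [norm_mul]
    exact mul_le_mul (aux_G_le t x y ht hx (le_of_lt hy)) (hφ y (le_of_lt hy)) (norm_nonneg _)
      (ProbabilityTheory.gaussianPDFReal_nonneg _ _ _)
  refine h1.trans ?_
  have h2 : ∫ y in Set.Ioi (0:ℝ),
      ProbabilityTheory.gaussianPDFReal x (Real.toNNReal (2 * t)) y * M ≤
      ∫ y, ProbabilityTheory.gaussianPDFReal x (Real.toNNReal (2 * t)) y * M :=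
    setIntegral_le_integral (hint.mul_const M) (Filter.Eventually.of_forall fun y =>
      mul_nonneg (ProbabilityTheory.gaussianPDFReal_nonneg _ _ _) hM)
  refine h2.trans ?_
  rw [MeasureTheory.integral_mul_const, ProbabilityTheory.integral_gaussianPDFReal_eq_one, one_mul]
  simpa using ht

lemma aux_integrable (t x M : ℝ) (ht : 0 < t) (hx : 0 ≤ x) (φ : ℝ → ℝ) (hm : Measurable φ)
    (hφ : ∀ y ≥ 0, |φ y| ≤ M) :
    IntegrableOn (fun y => heatG t x y * φ y) (Set.Ioi (0:ℝ)) := by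
  have hint := ProbabilityTheory.integrable_gaussianPDFReal x (Real.toNNReal (2 * t))
  refine Integrable.mono' (hint.mul_const M).integrableOn ?_ ?_
  · have : Measurable (fun y => heatG t x y) :=
      aux_G_meas.comp (measurable_const.prodMk (measurable_const.prodMk measurable_id))
    exact (this.mul hm).aestronglyMeasurable
  · refine (ae_restrict_iff' measurableSet_Ioi).2 (Filter.Eventually.of_forall fun y hy => ?_)
    rw [norm_mul]
    exact mul_le_mul (aux_G_le t x y ht hx (le_of_lt hy)) (hφ y (le_of_lt hy)) (norm_nonneg _)
      (ProbabilityTheory.gaussianPDFReal_nonneg _ _ _)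

lemma aux_diff (t x M D : ℝ) (ht : 0 < t) (hx : 0 ≤ x) (φ χ : ℝ → ℝ) (hm : Measurable φ)
    (hm' : Measurable χ) (hφ : ∀ y ≥ 0, |φ y| ≤ M) (hχ : ∀ y ≥ 0, |χ y| ≤ M)
    (hD : ∀ y ≥ 0, |φ y - χ y| ≤ D) :
    |(∫ y in Set.Ioi (0:ℝ), heatG t x y * φ y) - ∫ y in Set.Ioi (0:ℝ), heatG t x y * χ y| ≤ D := by
  rw [← integral_sub (aux_integrable t x M ht hx φ hm hφ) (aux_integrable t x M ht hx χ hm' hχ)]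
  simp only [← mul_sub]
  exact aux_bound t x D ht hx _ hD

lemma aux_S_bound (μ s x M : ℝ) (hs : 0 ≤ s) (hx : 0 ≤ x) (φ : ℝ → ℝ)
    (hφ : ∀ y ≥ 0, |φ y| ≤ M) : |heatS μ s φ x| ≤ Real.exp (-μ * s) * M := by
  unfold heatS
  split_ifs with h
  · simpa [h] using hφ x hx
  · rw [abs_mul, abs_of_pos (Real.exp_pos _)]
    gcongr
    exact aux_bound s x M (lt_of_le_of_ne hs (Ne.symm h)) hx φ hφ

lemma aux_S_diff (μ s x M D : ℝ) (hs : 0 ≤ s) (hx : 0 ≤ x) (φ χ : ℝ → ℝ) (hm : Measurable φ)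
    (hm' : Measurable χ) (hφ : ∀ y ≥ 0, |φ y| ≤ M) (hχ : ∀ y ≥ 0, |χ y| ≤ M)
    (hD : ∀ y ≥ 0, |φ y - χ y| ≤ D) :
    |heatS μ s φ x - heatS μ s χ x| ≤ Real.exp (-μ * s) * D := by
  unfold heatS
  split_ifs with h
  · simpa [h] using hD x hx
  · rw [← mul_sub, abs_mul, abs_of_pos (Real.exp_pos _)]
    gcongr
    exact aux_diff s x M D (lt_of_le_of_ne hs (Ne.symm h)) hx φ χ hm hm' hφ hχ hD

lemma aux_K_meas (α : ℝ) (g : ℝ → ℝ → ℝ) (hg : Measurable (fun p : ℝ × ℝ => g p.1 p.2)) :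
    Measurable (fun p : ℝ × ℝ => Kop α (g p.1) p.2) := by
  unfold Kop
  have h1 : Measurable (fun q : (ℝ × ℝ) × ℝ => heatG α q.1.2 q.2 * g q.1.1 q.2) := by
    refine Measurable.mul ?_ ?_
    · exact aux_G_meas.comp (measurable_const.prodMk
        ((measurable_snd.comp measurable_fst).prodMk measurable_snd))
    · exact hg.comp ((measurable_fst.comp measurable_fst).prodMk measurable_snd)
  exact (h1.stronglyMeasurable.integral_prod_right' (ν := volume.restrict (Set.Ioi (0:ℝ)))).measurable

lemma aux_S_meas (μ t x : ℝ) (g : ℝ → ℝ → ℝ) (hg : Measurable (fun p : ℝ × ℝ => g p.1 p.2)) :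
    Measurable (fun r => heatS μ (t - r) (g r) x) := by
  unfold heatS
  have h1 : Measurable (fun q : ℝ × ℝ => heatG (t - q.1) x q.2 * g q.1 q.2) := by
    refine Measurable.mul ?_ hg
    exact aux_G_meas.comp ((measurable_const.sub measurable_fst).prodMk
        (measurable_const.prodMk measurable_snd))
  have h2 : Measurable (fun r : ℝ => ∫ y in Set.Ioi (0:ℝ), heatG (t - r) x y * g r y) :=
    (h1.stronglyMeasurable.integral_prod_right' (ν := volume.restrict (Set.Ioi (0:ℝ)))).measurable
  refine Measurable.ite ?_ ?_ ?_
  · exact measurableSet_eq_fun (measurable_const.sub measurable_id) measurable_const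
  · exact hg.comp (measurable_id.prodMk measurable_const)
  · exact Measurable.mul (by fun_prop) h2

lemma aux_K_congr (α : ℝ) (φ χ : ℝ → ℝ) (h : ∀ y ≥ 0, φ y = χ y) : Kop α φ = Kop α χ := by
  funext x
  unfold Kop
  refine setIntegral_congr_fun measurableSet_Ioi fun y hy => ?_
  simp only [h y (le_of_lt hy)]

lemma aux_exp_int (μ t : ℝ) (hμ : 0 < μ) :
    ∫ r in (0:ℝ)..t, Real.exp (-μ * (t - r)) = (1 - Real.exp (-μ * t)) / μ := by
  have hd : ∀ r ∈ Set.uIcc 0 t, HasDerivAt (fun r => Real.exp (-μ * (t - r)) / μ)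
      (Real.exp (-μ * (t - r))) r := by
    intro r _
    have h0 : HasDerivAt (fun r : ℝ => -μ * (t - r)) μ r := by
      simpa using ((hasDerivAt_id r).const_sub t).const_mul (-μ)
    have h1 := h0.exp.div_const μ
    rwa [mul_div_cancel_right₀ _ hμ.ne'] at h1
  rw [integral_eq_sub_of_hasDerivAt hd (by apply Continuous.intervalIntegrable; fun_prop)]
  simp
  ring

lemma aux_sec (g : ℝ → ℝ → ℝ) (hg : Measurable (fun p : ℝ × ℝ => g p.1 p.2)) (r : ℝ) :
    Measurable (g r) :=
  hg.comp (measurable_const.prodMk measurable_id : Measurable fun y : ℝ => (r, y))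

lemma aux_SK_diff (μ α s x M D : ℝ) (hα : 0 < α) (hs : 0 ≤ s) (hx : 0 ≤ x) (g1 g2 : ℝ → ℝ → ℝ)
    (m1 : Measurable (fun p : ℝ × ℝ => g1 p.1 p.2))
    (m2 : Measurable (fun p : ℝ × ℝ => g2 p.1 p.2)) (r : ℝ)
    (b1 : ∀ y ≥ 0, |g1 r y| ≤ M) (b2 : ∀ y ≥ 0, |g2 r y| ≤ M)
    (hD : ∀ y ≥ 0, |g1 r y - g2 r y| ≤ D) :
    |heatS μ s (Kop α (g1 r)) x - heatS μ s (Kop α (g2 r)) x| ≤ Real.exp (-μ * s) * D :=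
  aux_S_diff μ s x M D hs hx (Kop α (g1 r)) (Kop α (g2 r))
    (aux_sec (fun r => Kop α (g1 r)) (aux_K_meas α g1 m1) r)
    (aux_sec (fun r => Kop α (g2 r)) (aux_K_meas α g2 m2) r)
    (fun y hy => aux_bound α y M hα hy (g1 r) b1)
    (fun y hy => aux_bound α y M hα hy (g2 r) b2)
    (fun y hy => aux_diff α y M D hα hy (g1 r) (g2 r) (aux_sec g1 m1 r) (aux_sec g2 m2 r) b1 b2 hD)

/-- Main package: the integrand for one curve `g`. -/
lemma aux_F_int (μ α t x B : ℝ) (hα : 0 < α) (hμ : 0 < μ) (ht : 0 ≤ t) (hx : 0 ≤ x)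
    (g : ℝ → ℝ → ℝ) (hg : Measurable (fun p : ℝ × ℝ => g p.1 p.2))
    (hB : ∀ r, ∀ y ≥ 0, |g r y| ≤ B) :
    IntervalIntegrable (fun r => heatS μ (t - r) (Kop α (g r)) x) volume 0 t := by
  rw [intervalIntegrable_iff_integrableOn_Ioc_of_le ht]
  refine Integrable.mono' (g := fun r => Real.exp (-μ * (t - r)) * B) ?_ ?_ ?_
  · exact (Continuous.integrableOn_Ioc (by fun_prop))
  · exact (aux_S_meas μ t x (fun r => Kop α (g r)) (aux_K_meas α g hg)).aestronglyMeasurable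
  · refine (ae_restrict_iff' measurableSet_Ioc).2 (Filter.Eventually.of_forall fun r hr => ?_)
    exact aux_S_bound μ (t - r) x B (by linarith [hr.2]) hx _
      (fun y hy => aux_bound α y B hα hy _ (hB r))

/-- Contraction estimate (cf. (3.19)): for any two continuous curves `u¹, u²` in `X` that
agree with `ψ` on `[-τ, 0]`, and every `t ∈ [0, T]`,
`‖(Λu¹)(t) - (Λu²)(t)‖ ≤ (ε L_f / μ)(1 - e^{-μt}) sup_{s ∈ [-τ, t]} ‖u¹(s) - u²(s)‖`. -/
theorem stmt_19 (μ ε α τ Lf T : ℝ) (hμ : 0 < μ) (hε : 0 < ε) (hα : 0 < α) (hτ : 0 < τ)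
    (hLf : 0 < Lf) (hT : 0 < T)
    (f : ℝ → ℝ) (hf : ContDiff ℝ 1 f) (hf0 : f 0 = 0) (hf' : ∀ s, |deriv f s| ≤ Lf)
    (ζ : ℝ → ℝ → ℝ) (hζX : ∀ t ∈ Set.Icc (-τ) T, InX (ζ t))
    (hζc : XContOn ζ (Set.Icc (-τ) T)) (hζb : XBddOn ζ (Set.Icc (-τ) T))
    (h : ℝ → ℝ → ℝ) (hhX : ∀ t ∈ Set.Icc (0:ℝ) T, InX (h t))
    (hhc : XContOn h (Set.Icc 0 T)) (hhb : XBddOn h (Set.Icc 0 T))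
    (ψ : ℝ → ℝ → ℝ) (hψX : ∀ t ∈ Set.Icc (-τ) (0:ℝ), InX (ψ t))
    (hψc : XContOn ψ (Set.Icc (-τ) 0))
    (u1 u2 : ℝ → ℝ → ℝ)
    (hu1X : ∀ t ∈ Set.Icc (-τ) T, InX (u1 t)) (hu1c : XContOn u1 (Set.Icc (-τ) T))
    (hu2X : ∀ t ∈ Set.Icc (-τ) T, InX (u2 t)) (hu2c : XContOn u2 (Set.Icc (-τ) T))
    (hu1ψ : ∀ t ∈ Set.Icc (-τ) (0:ℝ), ∀ x, u1 t x = ψ t x)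
    (hu2ψ : ∀ t ∈ Set.Icc (-τ) (0:ℝ), ∀ x, u2 t x = ψ t x) :
    ∀ t ∈ Set.Icc (0:ℝ) T,
      Xnorm (fun x => Lam μ ε α τ f ζ h ψ u1 t x - Lam μ ε α τ f ζ h ψ u2 t x) ≤
        (ε * Lf / μ) * (1 - Real.exp (-μ * t)) *
          ⨆ s : Set.Icc (-τ) t, Xnorm (fun x => u1 (s : ℝ) x - u2 (s : ℝ) x) := by
  intro t ht
  have hLip : ∀ a b, |f a - f b| ≤ Lf * |a - b| := by
    intro a b
    have := Convex.norm_image_sub_le_of_norm_deriv_le (f := f) (s := Set.univ) (C := Lf)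
      (x := b) (y := a)
      (fun x _ => (hf.differentiable (by norm_num)).differentiableAt) (fun x _ => hf' x) convex_univ
      (Set.mem_univ _) (Set.mem_univ _)
    simpa using this
  have hab : -τ ≤ T := by linarith
  have hfc : Continuous f := hf.continuous
  obtain ⟨M1, hM1⟩ := aux_unif_bdd u1 _ _ hu1X hu1c
  obtain ⟨M2, hM2⟩ := aux_unif_bdd u2 _ _ hu2X hu2c
  obtain ⟨M3, hM3⟩ := aux_unif_bdd ζ _ _ hζX hζc
  have c1 := aux_cont u1 _ _ hab hu1X hu1c
  have c2 := aux_cont u2 _ _ hab hu2X hu2c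
  have c3 := aux_cont ζ _ _ hab hζX hζc
  set D := ⨆ s : Set.Icc (-τ) t, Xnorm (fun x => u1 (s : ℝ) x - u2 (s : ℝ) x) with hD
  have hDb : ∀ s ∈ Set.Icc (-τ) t, ∀ y ≥ (0:ℝ), |u1 s y - u2 s y| ≤ D := by
    intro s hs y hy
    have hsT : s ∈ Set.Icc (-τ) T := ⟨hs.1, hs.2.trans ht.2⟩
    refine (aux_le_Xnorm (fun x => u1 s x - u2 s x)
      (aux_bdd_sub (hu1X s hsT).1 (hu2X s hsT).1) y hy).trans ?_
    have hB : BddAbove (Set.range fun s : Set.Icc (-τ) t =>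
        Xnorm (fun x => u1 (s : ℝ) x - u2 (s : ℝ) x)) := by
      refine ⟨M1 + M2, ?_⟩
      rintro _ ⟨r, rfl⟩
      have hrT : (r:ℝ) ∈ Set.Icc (-τ) T := ⟨r.2.1, r.2.2.trans ht.2⟩
      exact aux_Xnorm_le _ _ fun x hx =>
        (abs_sub _ _).trans (add_le_add (hM1 r hrT x hx) (hM2 r hrT x hx))
    exact le_ciSup hB ⟨s, hs⟩
  have hD0 : 0 ≤ D := (abs_nonneg _).trans (hDb 0 ⟨by linarith, ht.1⟩ 0 le_rfl)
  have hexp : Real.exp (-μ * t) ≤ 1 := Real.exp_le_one_iff.2 (by nlinarith [ht.1])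
  apply aux_Xnorm_le
  intro x hx
  unfold Lam
  split_ifs with h0
  · simp only [sub_self, abs_zero]
    have : 0 ≤ 1 - Real.exp (-μ * t) := by linarith
    positivity
  rw [not_le] at h0
  let cl : ℝ → ℝ := fun r => max (-τ) (min T (r - τ))
  have hcl : ∀ r, cl r ∈ Set.Icc (-τ) T := fun r =>
    ⟨le_max_left _ _, max_le hab (min_le_left _ _)⟩
  have hcl2 : ∀ r ∈ Set.Icc 0 t, cl r = r - τ := by
    intro r hr
    simp only [cl]
    rw [min_eq_right (by linarith [hr.2, ht.2]), max_eq_right (by linarith [hr.1])]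
  let g1 : ℝ → ℝ → ℝ := fun r y => f (u1 (cl r) (max y 0) + ζ (cl r) (max y 0))
  let g2 : ℝ → ℝ → ℝ := fun r y => f (u2 (cl r) (max y 0) + ζ (cl r) (max y 0))
  have sh : Continuous (fun p : ℝ × ℝ => (p.1 - τ, p.2)) := by fun_prop
  have m1 : Measurable (fun p : ℝ × ℝ => g1 p.1 p.2) :=
    (hfc.comp ((c1.comp sh).add (c3.comp sh))).measurable
  have m2 : Measurable (fun p : ℝ × ℝ => g2 p.1 p.2) :=
    (hfc.comp ((c2.comp sh).add (c3.comp sh))).measurable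
  have hfb : ∀ a, |f a| ≤ Lf * |a| := fun a => by simpa [hf0] using hLip a 0
  have b1 : ∀ r, ∀ y ≥ 0, |g1 r y| ≤ Lf * (max M1 M2 + M3) := by
    intro r y _
    refine (hfb _).trans (mul_le_mul_of_nonneg_left ?_ hLf.le)
    exact (abs_add_le _ _).trans (add_le_add ((hM1 _ (hcl r) _ (le_max_right _ _)).trans
      (le_max_left _ _)) (hM3 _ (hcl r) _ (le_max_right _ _)))
  have b2 : ∀ r, ∀ y ≥ 0, |g2 r y| ≤ Lf * (max M1 M2 + M3) := by
    intro r y _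
    refine (hfb _).trans (mul_le_mul_of_nonneg_left ?_ hLf.le)
    exact (abs_add_le _ _).trans (add_le_add ((hM2 _ (hcl r) _ (le_max_right _ _)).trans
      (le_max_right _ _)) (hM3 _ (hcl r) _ (le_max_right _ _)))
  have e1 : ∫ r in (0:ℝ)..t, heatS μ (t - r) (Kop α (fun y => f (u1 (r - τ) y + ζ (r - τ) y))) x
      = ∫ r in (0:ℝ)..t, heatS μ (t - r) (Kop α (g1 r)) x := by
    refine integral_congr fun r hr => ?_
    rw [Set.uIcc_of_le ht.1] at hr
    beta_reduce
    rw [aux_K_congr α _ (g1 r)]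
    intro y hy
    simp only [g1, hcl2 r hr, max_eq_left hy]
  have e2 : ∫ r in (0:ℝ)..t, heatS μ (t - r) (Kop α (fun y => f (u2 (r - τ) y + ζ (r - τ) y))) x
      = ∫ r in (0:ℝ)..t, heatS μ (t - r) (Kop α (g2 r)) x := by
    refine integral_congr fun r hr => ?_
    rw [Set.uIcc_of_le ht.1] at hr
    beta_reduce
    rw [aux_K_congr α _ (g2 r)]
    intro y hy
    simp only [g2, hcl2 r hr, max_eq_left hy]
  rw [e1, e2]
  have i1 := aux_F_int μ α t x _ hα hμ ht.1 hx g1 m1 b1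
  have i2 := aux_F_int μ α t x _ hα hμ ht.1 hx g2 m2 b2
  have key : |(∫ r in (0:ℝ)..t, heatS μ (t - r) (Kop α (g1 r)) x)
      - ∫ r in (0:ℝ)..t, heatS μ (t - r) (Kop α (g2 r)) x|
      ≤ (1 - Real.exp (-μ * t)) / μ * (Lf * D) := by
    rw [← integral_sub i1 i2, ← aux_exp_int μ t hμ, ← intervalIntegral.integral_mul_const]
    have hi : IntervalIntegrable (fun r => Real.exp (-μ * (t - r)) * (Lf * D)) volume 0 t :=
      Continuous.intervalIntegrable (by fun_prop) 0 t
    rw [← Real.norm_eq_abs]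
    refine intervalIntegral.norm_integral_le_of_norm_le ht.1
      (Filter.Eventually.of_forall fun r hr => ?_)
      hi
    have hr' : r ∈ Set.Icc 0 t := ⟨hr.1.le, hr.2⟩
    refine aux_SK_diff μ α (t - r) x _ (Lf * D) hα (by linarith [hr.2]) hx g1 g2 m1 m2 r
      (b1 r) (b2 r) ?_
    intro z hz
    refine (hLip _ _).trans (mul_le_mul_of_nonneg_left ?_ hLf.le)
    rw [add_sub_add_right_eq_sub, hcl2 r hr']
    exact hDb _ ⟨by linarith [hr'.1], by linarith [hr'.2]⟩ _ (le_max_right _ _)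
  rw [add_sub_add_right_eq_sub, add_sub_add_left_eq_sub, ← mul_sub, abs_mul, abs_of_pos hε]
  refine (mul_le_mul_of_nonneg_left key hε.le).trans (le_of_eq ?_)
  field_simp
end
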